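/- A finite simple graph G=(V,E) is an interval graph if and only if the reflexive symmetric relation R(G) on V, defined by u R(G) v iff u=v or uv ∈ E, is the intersection of two Ferrers relations on V×V; that is, if and only if the bipartite graph whose biadjacency matrix is the augmented adjacency matrix of G has Ferrers dimension at most 2. -/

import Mathlib

/-- A finite simple graph is an interval graph if each vertex can be assigned a
nonempty closed real interval such that two distinct vertices are adjacent iff
their intervals intersect. -/
def IsIntervalGraph {V : Type*} (G : SimpleGraph V) : Prop :=
  ∃ a b : V → ℝ, (∀ v, a v ≤ b v) ∧
    ∀ u v : V, u ≠ v →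
      (G.Adj u v ↔ (Set.Icc (a u) (b u) ∩ Set.Icc (a v) (b v)).Nonempty)

/-- A relation `F : X → Y → Prop` is a Ferrers relation if the neighborhoods
`n(x) = {y | F x y}` are linearly ordered by inclusion; equivalently, there is no
`2 × 2` permutation submatrix. -/
def IsFerrers {X Y : Type*} (F : X → Y → Prop) : Prop :=
  ∀ (x x' : X) (y y' : Y), F x y → F x' y' → F x y' ∨ F x' y

/-- Comparing real numbers attached to the points of `X` and `Y` gives a Ferrers relation. -/
lemma IsFerrers.of_le {X Y : Type*} (a : X → ℝ) (b : Y → ℝ) :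
    IsFerrers fun x y => a x ≤ b y := by
  intro x x' y y' h h'
  rcases le_total (a x) (a x') with h₁ | h₁
  · exact Or.inl (h₁.trans h')
  · exact Or.inr (h₁.trans h)

lemma IsFerrers.flip {X Y : Type*} {F : X → Y → Prop} (hF : IsFerrers F) :
    IsFerrers fun y x => F x y :=
  fun y y' x x' h h' => (hF x x' y y' h h').symm

/-- A reflexive Ferrers relation on a finite type says that the left endpoint of `u` does
not exceed the right endpoint of `v`, for a suitable choice of endpoints. -/
lemma IsFerrers.exists_le_iff {V : Type*} [Fintype V] {F : V → V → Prop} (hF : IsFerrers F)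
    (hrefl : ∀ v, F v v) : ∃ a b : V → ℝ, ∀ u v, F u v ↔ a u ≤ b v := by
  classical
  let n : V → Finset V := fun u => Finset.univ.filter fun w => ¬ F u w
  let b : V → ℕ := fun v => (Finset.univ.filter fun u => F u v).sup fun u => (n u).card
  refine ⟨fun u => (n u).card, fun v => b v, fun u v => ?_⟩
  rw [Nat.cast_le]
  refine ⟨fun h => Finset.le_sup (f := fun u => (n u).card) (by simpa using h), fun h => ?_⟩
  obtain ⟨u', hu', hb⟩ := Finset.exists_mem_eq_sup (Finset.univ.filter fun u => F u v)
    ⟨v, by simpa using hrefl v⟩ fun u => (n u).card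
  have hu'v : F u' v := by simpa using hu'
  have hle : (n u).card ≤ (n u').card := h.trans_eq hb
  by_contra huv
  refine hle.not_gt (Finset.card_lt_card (Finset.ssubset_iff_of_subset ?_ |>.2 ⟨v, ?_, ?_⟩))
  · intro w hw
    simp only [n, Finset.mem_filter, Finset.mem_univ, true_and] at hw ⊢
    exact fun huw => (hF u u' w v huw hu'v).elim huv hw
  · simpa [n] using huv
  · simpa [n] using hu'v

/-- If a symmetric relation is the intersection of two reflexive Ferrers relations, then these
are converse to each other. -/
lemma IsFerrers.iff_flip_of_symmetric_inter {V : Type*} {F₁ F₂ : V → V → Prop}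
    (h₁ : IsFerrers F₁) (h₂ : IsFerrers F₂) (r₁ : ∀ v, F₁ v v) (r₂ : ∀ v, F₂ v v)
    (hsymm : ∀ u v, F₁ u v ∧ F₂ u v → F₁ v u ∧ F₂ v u) (u v : V) : F₂ u v ↔ F₁ v u := by
  have := h₁ u v u v (r₁ u) (r₁ v)
  have := h₂ u v u v (r₂ u) (r₂ v)
  have := hsymm u v
  have := hsymm v u
  tauto

lemma Icc_inter_Icc_nonempty_iff {a b c d : ℝ} (hab : a ≤ b) (hcd : c ≤ d) :
    (Set.Icc a b ∩ Set.Icc c d).Nonempty ↔ a ≤ d ∧ c ≤ b := by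
  rw [Set.Icc_inter_Icc, Set.nonempty_Icc, sup_le_iff, le_inf_iff, le_inf_iff]
  tauto

/-- A finite simple graph `G` is an interval graph iff the reflexive
symmetric relation `u = v ∨ uv ∈ E` (the augmented adjacency matrix of `G`) is the
intersection of two Ferrers relations on `V × V`, i.e. iff the corresponding
bipartite graph has Ferrers dimension at most `2`. -/
theorem intervalGraph_iff_ferrersDimension_le_two
    {V : Type*} [Fintype V] (G : SimpleGraph V) :
    IsIntervalGraph G ↔
      ∃ F₁ F₂ : V → V → Prop, IsFerrers F₁ ∧ IsFerrers F₂ ∧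
        ∀ u v : V, (u = v ∨ G.Adj u v) ↔ (F₁ u v ∧ F₂ u v) := by
  constructor
  · rintro ⟨a, b, hab, hG⟩
    refine ⟨fun u v => a u ≤ b v, fun u v => a v ≤ b u, .of_le a b, (IsFerrers.of_le a b).flip,
      fun u v => ?_⟩
    rcases eq_or_ne u v with rfl | huv
    · simp [hab]
    · rw [hG u v huv, Icc_inter_Icc_nonempty_iff (hab u) (hab v)]
      simp [huv]
  · rintro ⟨F₁, F₂, h₁, h₂, hG⟩
    have hr v : F₁ v v ∧ F₂ v v := (hG v v).1 (Or.inl rfl)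
    have hflip := h₁.iff_flip_of_symmetric_inter h₂ (fun v => (hr v).1) (fun v => (hr v).2)
      fun u v h => (hG v u).1 (((hG u v).2 h).imp Eq.symm G.adj_symm)
    obtain ⟨a, b, hF⟩ := h₁.exists_le_iff fun v => (hr v).1
    have hab v : a v ≤ b v := (hF v v).1 (hr v).1
    refine ⟨a, b, hab, fun u v huv => ?_⟩
    rw [Icc_inter_Icc_nonempty_iff (hab u) (hab v), ← hF, ← hF, ← hflip u v, ← hG]
    simp [huv]
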